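/- Let p ∈ 𝕊^M, t > 0 and let r ≥ 1 be an integer. There exist l ∈ {2,…,M}, an intensity vector λ = (λ₂,…,λ_{M−1}) with λ_j ≥ 0, β ∈ (0,1] and h₀ ∈ (0,1) such that for every h ∈ (0,h₀) there exists α ∈ [(1 + (kλ)*·t/r)^{−r}, 1], where (kλ)* = max_{2≤j≤M−1} k̃_jλ_j, such that, setting a = t/(t+hr), the matrix I − a·P̃^{(h)}(λ) is invertible and for every j ∈ {1,…,M}: (1−a)^r·[(1−β)·(((I − a·P̃^{(h)}(λ))^{−r}))_{l−1,j} + β·(((I − a·P̃^{(h)}(λ))^{−r}))_{l,j}] = α·p_j. (This is the distribution of the discrete-time chain with one-step transition matrix P̃^{(h)} stopped at an independent negative binomial time τ ~ NB(r, t/(t+hr)), which has mean E[hτ] = t.) -/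

import Mathlib

noncomputable section

open Finset MeasureTheory

/-- Paper index `j ∈ {1,…,M+1}` as an element of `Fin (M+1)`. -/
def fid (M j : ℕ) : Fin (M + 1) := ⟨(j - 1) % (M + 1), Nat.mod_lt _ (Nat.succ_pos M)⟩

/-- `q_{j,j+1}` built from the grid `i` and the drift `b`. -/
def qup (i b : ℕ → ℝ) (j : ℕ) : ℝ :=
  ((i j - i (j - 1)) / (i (j + 1) - i (j - 1))) * (1 + (i (j + 1) - i j) * b j)

/-- `q_{j,j-1}` built from the grid `i` and the drift `b`. -/
def qdn (i b : ℕ → ℝ) (j : ℕ) : ℝ :=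
  ((i (j + 1) - i j) / (i (j + 1) - i (j - 1))) * (1 - (i j - i (j - 1)) * b j)

/-- `k̃_j = (i_{j+1}-i_j)(i_j-i_{j-1}) k_j` for `2 ≤ j ≤ M-1`, and `0` otherwise. -/
def ktil (M : ℕ) (i k : ℕ → ℝ) (j : ℕ) : ℝ :=
  if 2 ≤ j ∧ j ≤ M - 1 then (i (j + 1) - i j) * (i j - i (j - 1)) * k j else 0

/-- The drift hypothesis `-1/(i_{j+1}-i_j) < b_j < 1/(i_j - i_{j-1})`. -/
def DriftHyp (M : ℕ) (i b : ℕ → ℝ) : Prop :=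
  ∀ j, 2 ≤ j → j ≤ M - 1 →
    -(1 / (i (j + 1) - i j)) < b j ∧ b j < 1 / (i j - i (j - 1))

/-- An intensity vector: nonnegative on `{2,…,M-1}` and (by convention) `0` elsewhere. -/
def IntensityVec (M : ℕ) (lam : ℕ → ℝ) : Prop :=
  (∀ j, 2 ≤ j → j ≤ M - 1 → 0 ≤ lam j) ∧ (∀ j, ¬(2 ≤ j ∧ j ≤ M - 1) → lam j = 0)

/-- `p ∈ 𝕊^M`. -/
def ProbVec (M : ℕ) (p : ℕ → ℝ) : Prop :=
  (∀ j, 1 ≤ j → j ≤ M → 0 < p j) ∧ ∑ j ∈ Finset.Icc 1 M, p j = 1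

/-- `κ` are martingale coordinates for `(i,b)`. -/
def MartCoord (M : ℕ) (i b κ : ℕ → ℝ) : Prop :=
  (∀ j, 1 ≤ j → j ≤ M - 1 → κ j < κ (j + 1)) ∧
  (∀ j, 2 ≤ j → j ≤ M - 1 →
    qup i b j = (κ j - κ (j - 1)) / (κ (j + 1) - κ (j - 1)) ∧
    qdn i b j = (κ (j + 1) - κ j) / (κ (j + 1) - κ (j - 1)))

/-- The point `x₀` of the G-system. -/
def Gx0 (M : ℕ) (s : ℝ) (κ kt P G : ℕ → ℝ) : ℝ :=
  (∑ j ∈ Finset.Icc 1 M, κ j * P j * (1 + s * G j * kt j)) /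
    (∑ j ∈ Finset.Icc 1 M, P j * (1 + s * G j * kt j))

/-- `(G, l)` solves the G-system with time parameter `s` and probability vector `P`. -/
def GSystem (M : ℕ) (s : ℝ) (κ kt P G : ℕ → ℝ) (l : ℕ) : Prop :=
  2 ≤ l ∧ l ≤ M ∧
  (∀ j, 1 ≤ j → j ≤ M → 0 ≤ G j) ∧ G 1 = 0 ∧ G M = 0 ∧
  κ (l - 1) < Gx0 M s κ kt P G ∧ Gx0 M s κ kt P G ≤ κ l ∧
  (∀ j, 2 ≤ j → j ≤ l - 1 →
    G j = (1 / (s * P j)) *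
      ((κ (j + 1) - κ (j - 1)) / ((κ (j + 1) - κ j) * (κ j - κ (j - 1)))) *
      ∑ a ∈ Finset.Icc 1 (j - 1), (κ j - κ a) * P a * (1 + s * G a * kt a)) ∧
  (∀ j, l ≤ j → j ≤ M - 1 →
    G j = (1 / (s * P j)) *
      ((κ (j + 1) - κ (j - 1)) / ((κ (j + 1) - κ j) * (κ j - κ (j - 1)))) *
      ∑ a ∈ Finset.Icc (j + 1) M, (κ a - κ j) * P a * (1 + s * G a * kt a))

/-- Entry `(j,c)` (paper indices in `{1,…,M+1}`) of the matrix `Ñ_t(λ)`. -/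
def NtE (M : ℕ) (t : ℝ) (i b k lam : ℕ → ℝ) (j c : ℕ) : ℝ :=
  if 2 ≤ j ∧ j ≤ M - 1 then
    if c = j then 1 + t * lam j * (1 + ktil M i k j)
    else if c = j + 1 then -(t * lam j * qup i b j)
    else if c = j - 1 then -(t * lam j * qdn i b j)
    else if c = M + 1 then -(t * lam j * ktil M i k j)
    else 0
  else if c = j then 1 else 0

/-- The `(M+1)×(M+1)` matrix `Ñ_t(λ)`. -/
def Ntilde (M : ℕ) (t : ℝ) (i b k lam : ℕ → ℝ) : Matrix (Fin (M + 1)) (Fin (M + 1)) ℝ :=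
  Matrix.of fun u v => NtE M t i b k lam (u.1 + 1) (v.1 + 1)

/-- The top-left `M×M` block `N_t(λ)` of `Ñ_t(λ)`. -/
def NMat (M : ℕ) (t : ℝ) (i b k lam : ℕ → ℝ) : Matrix (Fin M) (Fin M) ℝ :=
  Matrix.of fun u v => NtE M t i b k lam (u.1 + 1) (v.1 + 1)

/-- Entry `(j,c)` (paper indices) of the one-step transition matrix `P̃^{(h)}(λ)`. -/
def PtE (M : ℕ) (h : ℝ) (i b k lam : ℕ → ℝ) (j c : ℕ) : ℝ :=
  if 2 ≤ j ∧ j ≤ M - 1 then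
    if c = j then 1 - h * lam j * (1 + ktil M i k j)
    else if c = j + 1 then h * lam j * qup i b j
    else if c = j - 1 then h * lam j * qdn i b j
    else if c = M + 1 then h * lam j * ktil M i k j
    else 0
  else if c = j then 1 else 0

/-- The `(M+1)×(M+1)` transition matrix `P̃^{(h)}(λ)`. -/
def Ptilde (M : ℕ) (h : ℝ) (i b k lam : ℕ → ℝ) : Matrix (Fin (M + 1)) (Fin (M + 1)) ℝ :=
  Matrix.of fun u v => PtE M h i b k lam (u.1 + 1) (v.1 + 1)

/-- Entry `(j,c)` (paper indices) of the intensity matrix `Θ(λ)`. -/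
def ThE (M : ℕ) (i b k lam : ℕ → ℝ) (j c : ℕ) : ℝ :=
  if 2 ≤ j ∧ j ≤ M - 1 then
    if c = j then -(lam j * (1 + ktil M i k j))
    else if c = j + 1 then lam j * qup i b j
    else if c = j - 1 then lam j * qdn i b j
    else if c = M + 1 then lam j * ktil M i k j
    else 0
  else 0

/-- The `(M+1)×(M+1)` intensity matrix `Θ(λ)`. -/
def Theta (M : ℕ) (i b k lam : ℕ → ℝ) : Matrix (Fin (M + 1)) (Fin (M + 1)) ℝ :=
  Matrix.of fun u v => ThE M i b k lam (u.1 + 1) (v.1 + 1)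


/-! ### Brouwer's fixed point theorem via Kuhn's triangulation -/

/-- A simplex of Kuhn's triangulation of `ℝ^(n+1)`: a base point and the order in which the
coordinates are increased. -/
abbrev KuhnCell (n : ℕ) := (Fin (n + 1) → ℤ) × Equiv.Perm (Fin (n + 1))

/-- The `m`-th vertex of a Kuhn simplex. -/
def kuhnVertex {n : ℕ} (s : KuhnCell n) (m : Fin (n + 2)) : Fin (n + 1) → ℤ :=
  fun j => s.1 j + if (s.2 j : ℕ) < m then 1 else 0

/-- The other pair (simplex, omitted vertex) that has the same facet. -/
def kuhnFlip {n : ℕ} (x : KuhnCell n × Fin (n + 2)) : KuhnCell n × Fin (n + 2) :=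
  if h0 : x.2 = 0 then
    ((fun j => x.1.1 j + if x.1.2 j = 0 then 1 else 0, x.1.2.trans (finRotate (n + 1)).symm),
      Fin.last (n + 1))
  else if h1 : x.2 = Fin.last (n + 1) then
    ((fun j => x.1.1 j - if x.1.2 j = Fin.last n then 1 else 0, x.1.2.trans (finRotate (n + 1))),
      0)
  else ((x.1.1, x.1.2.trans (Equiv.swap (x.2.pred h0) (x.2.castPred h1))), x.2)

lemma kuhnFlip_ne {n : ℕ} (x : KuhnCell n × Fin (n + 2)) : kuhnFlip x ≠ x := by
  obtain ⟨⟨v, ρ⟩, k⟩ := x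
  unfold kuhnFlip
  dsimp only
  split_ifs with h0 h1
  · intro h
    have := congrArg Prod.snd h
    simp only [h0] at this
    exact absurd this.symm (Fin.last_pos).ne
  · intro h
    have := congrArg Prod.snd h
    simp only [h1] at this
    exact absurd this (Fin.last_pos).ne
  · intro h
    have h2 := DFunLike.congr_fun (congrArg (fun y => y.1.2) h) (ρ.symm (k.pred h0))
    simp only [Equiv.trans_apply, Equiv.apply_symm_apply, Equiv.swap_apply_left] at h2
    have h3 := congrArg Fin.val h2
    have h4 : (k : ℕ) ≠ 0 := fun h => h0 (Fin.ext h)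
    simp only [Fin.coe_castPred, Fin.val_pred] at h3
    omega

lemma kuhnFlip_kuhnFlip {n : ℕ} (x : KuhnCell n × Fin (n + 2)) : kuhnFlip (kuhnFlip x) = x := by
  obtain ⟨⟨v, ρ⟩, k⟩ := x
  have hl : Fin.last (n + 1) ≠ 0 := (Fin.last_pos).ne'
  by_cases h0 : k = 0
  · subst h0
    simp only [kuhnFlip, dite_true, hl, dite_false]
    refine Prod.ext (Prod.ext ?_ ?_) rfl
    · funext j
      have : (finRotate (n + 1)).symm (ρ j) = Fin.last n ↔ ρ j = 0 := by
        rw [Equiv.symm_apply_eq, finRotate_last]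
      simp [Equiv.trans_apply, -finRotate_symm_apply, this]
    · ext j
      simp [Equiv.trans_apply]
  · by_cases h1 : k = Fin.last (n + 1)
    · subst h1
      simp only [kuhnFlip, dite_true, hl, dite_false]
      refine Prod.ext (Prod.ext ?_ ?_) rfl
      · funext j
        have : (finRotate (n + 1)) (ρ j) = 0 ↔ ρ j = Fin.last n := by
          rw [← Equiv.eq_symm_apply, Equiv.eq_symm_apply, ← finRotate_last,
            (finRotate (n + 1)).apply_eq_iff_eq]
        simp [Equiv.trans_apply, -finRotate_apply, this]
      · ext j
        simp [Equiv.trans_apply]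
    · simp only [kuhnFlip, h0, h1, dite_false]
      refine Prod.ext (Prod.ext rfl ?_) rfl
      ext j
      simp [Equiv.trans_apply]

lemma kuhnFlip_vertex {n : ℕ} (x : KuhnCell n × Fin (n + 2)) (m : Fin (n + 2)) (hm : m ≠ x.2) :
    ∃ m', m' ≠ (kuhnFlip x).2 ∧ kuhnVertex (kuhnFlip x).1 m' = kuhnVertex x.1 m := by
  obtain ⟨⟨v, ρ⟩, k⟩ := x
  have hl : Fin.last (n + 1) ≠ 0 := (Fin.last_pos).ne'
  by_cases h0 : k = 0
  · subst h0
    have hm0 : (m : ℕ) ≠ 0 := fun h => hm (Fin.ext h)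
    have hmlt := m.2
    refine ⟨⟨m - 1, by omega⟩, ?_, ?_⟩
    · simp only [kuhnFlip, dite_true]
      intro h
      have := congrArg Fin.val h
      simp at this
      omega
    · simp only [kuhnFlip, dite_true]
      funext j
      simp only [kuhnVertex, Equiv.trans_apply, finRotate_symm_apply, Fin.coe_sub_one]
      by_cases hj : ρ j = 0
      · have hm1 : 0 < m := Fin.pos_iff_ne_zero.2 hm
        simp [hj, hm1]
        omega
      · have : (ρ j : ℕ) ≠ 0 := fun h => hj (Fin.ext h)
        simp only [hj, if_false]
        split_ifs <;> omega
  · by_cases h1 : k = Fin.last (n + 1)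
    · subst h1
      have hmlt := m.2
      have hm0 : (m : ℕ) ≠ n + 1 := fun h => hm (Fin.ext h)
      refine ⟨⟨m + 1, by omega⟩, ?_, ?_⟩
      · simp only [kuhnFlip, dite_true, hl, dite_false]
        intro h
        have := congrArg Fin.val h
        simp at this
      · simp only [kuhnFlip, dite_true, hl, dite_false]
        funext j
        simp only [kuhnVertex, Equiv.trans_apply, coe_finRotate]
        by_cases hj : ρ j = Fin.last n
        · simp [hj]
          omega
        · simp only [hj, if_false]
          split_ifs <;> omega
    · refine ⟨m, ?_, ?_⟩
      · simpa only [kuhnFlip, h0, h1, dite_false] using hm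
      · simp only [kuhnFlip, h0, h1, dite_false]
        funext j
        have hmk : (m : ℕ) ≠ k := fun h => hm (Fin.ext h)
        have hk0 : (k : ℕ) ≠ 0 := fun h => h0 (Fin.ext h)
        simp only [kuhnVertex, Equiv.trans_apply, Equiv.swap_apply_def, Fin.ext_iff]
        congr 1
        split_ifs <;> simp_all <;> omega

/-- The facet opposite to the vertex `x.2` carries all labels but the last one. -/
def KuhnDoor {n : ℕ} (ℓ : (Fin (n + 1) → ℤ) → Fin (n + 2)) (x : KuhnCell n × Fin (n + 2)) : Prop :=
  ∀ c : Fin (n + 1), ∃ m, m ≠ x.2 ∧ ℓ (kuhnVertex x.1 m) = c.castSucc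

lemma KuhnDoor.flip {n : ℕ} {ℓ : (Fin (n + 1) → ℤ) → Fin (n + 2)} {x : KuhnCell n × Fin (n + 2)}
    (h : KuhnDoor ℓ x) : KuhnDoor ℓ (kuhnFlip x) := by
  intro c
  obtain ⟨m, hm, hc⟩ := h c
  obtain ⟨m', hm', he⟩ := kuhnFlip_vertex x m hm
  exact ⟨m', hm', he ▸ hc⟩

lemma kuhnDoor_flip_iff {n : ℕ} {ℓ : (Fin (n + 1) → ℤ) → Fin (n + 2)}
    {x : KuhnCell n × Fin (n + 2)} : KuhnDoor ℓ (kuhnFlip x) ↔ KuhnDoor ℓ x :=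
  ⟨fun h => kuhnFlip_kuhnFlip x ▸ h.flip, KuhnDoor.flip⟩

/-- Modulo two, the number of indices whose omission leaves all labels but the last one
tells whether all labels occur. -/
lemma sum_omit_label {n : ℕ} (a : Fin (n + 1) → Fin (n + 1)) [Decidable (Function.Surjective a)]
    [DecidablePred fun k => ∀ c, c ≠ Fin.last n → ∃ m, m ≠ k ∧ a m = c] :
    (∑ k, if ∀ c, c ≠ Fin.last n → ∃ m, m ≠ k ∧ a m = c then (1 : ZMod 2) else 0) =
      if Function.Surjective a then 1 else 0 := by
  have key : ∀ k, (∀ c, c ≠ Fin.last n → ∃ m, m ≠ k ∧ a m = c) →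
      ∀ m₁ m₂, m₁ ≠ k → m₂ ≠ k → a m₁ = a m₂ → m₁ = m₂ := by
    intro k hk
    choose! g hg using hk
    have hgi : Set.InjOn g ((univ.erase (Fin.last n) : Finset (Fin (n + 1)))) := by
      intro c hc c' hc' h
      simp only [coe_erase, coe_univ, Set.mem_sdiff, Set.mem_univ, Set.mem_singleton_iff,
        true_and] at hc hc'
      rw [← (hg c hc).2, ← (hg c' hc').2, h]
    have himg : (univ.erase (Fin.last n)).image g = univ.erase k := by
      apply Finset.eq_of_subset_of_card_le
      · intro m hm
        simp only [mem_image, mem_erase, mem_univ, and_true] at hm ⊢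
        obtain ⟨c, hc, rfl⟩ := hm
        exact (hg c hc).1
      · rw [card_image_of_injOn hgi]; simp
    intro m₁ m₂ h₁ h₂ h
    have e₁ : m₁ ∈ (univ.erase (Fin.last n)).image g := by simp [himg, h₁]
    have e₂ : m₂ ∈ (univ.erase (Fin.last n)).image g := by simp [himg, h₂]
    simp only [mem_image, mem_erase, mem_univ, and_true] at e₁ e₂
    obtain ⟨c₁, hc₁, rfl⟩ := e₁
    obtain ⟨c₂, hc₂, rfl⟩ := e₂
    rw [(hg _ hc₁).2, (hg _ hc₂).2] at h
    rw [h]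
  by_cases hs : Function.Surjective a
  · rw [if_pos hs]
    have hinj : Function.Injective a := Finite.injective_iff_surjective.2 hs
    obtain ⟨k₀, hk₀⟩ := hs (Fin.last n)
    rw [Finset.sum_eq_single k₀]
    · rw [if_pos]
      intro c hc
      obtain ⟨m, rfl⟩ := hs c
      exact ⟨m, fun h => hc (h ▸ hk₀), rfl⟩
    · intro k _ hk
      rw [if_neg]
      intro h
      obtain ⟨m, hm, he⟩ := h (a k) (fun h => hk (hinj (h.trans hk₀.symm)))
      exact hm (hinj he)
    · simp
  · rw [if_neg hs]
    by_cases hex : ∃ k, ∀ c, c ≠ Fin.last n → ∃ m, m ≠ k ∧ a m = c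
    · obtain ⟨k, hk⟩ := hex
      have hak : a k ≠ Fin.last n := by
        intro h
        apply hs
        intro c
        by_cases hc : c = Fin.last n
        · exact ⟨k, h.trans hc.symm⟩
        · obtain ⟨m, -, hm⟩ := hk c hc
          exact ⟨m, hm⟩
      obtain ⟨m, hmk, hm⟩ := hk (a k) hak
      have hm' : ∀ c, c ≠ Fin.last n → ∃ m', m' ≠ m ∧ a m' = c := by
        intro c hc
        obtain ⟨m', h', he⟩ := hk c hc
        by_cases hmm : m' = m
        · exact ⟨k, hmk.symm, by rw [← he, hmm, hm]⟩
        · exact ⟨m', hmm, he⟩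
      rw [Finset.sum_eq_add_of_mem k m (mem_univ _) (mem_univ _) hmk.symm]
      · rw [if_pos hk, if_pos hm']; decide
      · intro j _ hj
        rw [if_neg]
        intro h
        exact hmk (key j h _ _ hj.2.symm hj.1.symm hm)
    · exact Finset.sum_eq_zero fun k _ => if_neg fun h => hex ⟨k, h⟩

lemma sum_kuhnDoor {n : ℕ} (ℓ : (Fin (n + 1) → ℤ) → Fin (n + 2)) (s : KuhnCell n)
    [DecidablePred (KuhnDoor ℓ)] [Decidable (Function.Surjective fun m => ℓ (kuhnVertex s m))] :
    (∑ k, if KuhnDoor ℓ (s, k) then (1 : ZMod 2) else 0) =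
      if Function.Surjective fun m => ℓ (kuhnVertex s m) then 1 else 0 := by
  classical
  rw [← sum_omit_label fun m => ℓ (kuhnVertex s m)]
  refine Finset.sum_congr rfl fun k _ => if_congr ?_ rfl rfl
  constructor
  · intro h c hc
    obtain ⟨m, hm, he⟩ := h (c.castPred hc)
    exact ⟨m, hm, by simpa using he⟩
  · intro h c
    exact h c.castSucc (Fin.castSucc_lt_last c).ne

/-- If two labellings differ at finitely many points only, and the first one has exactly one
simplex with all labels, then the second one has such a simplex as well. -/
lemma exists_surjective_label {n : ℕ} (ℓ₀ ℓ : (Fin (n + 1) → ℤ) → Fin (n + 2))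
    (hfin : {v | ℓ₀ v ≠ ℓ v}.Finite) (s₀ : KuhnCell n)
    (hs₀ : ∀ s, (Function.Surjective fun m => ℓ₀ (kuhnVertex s m)) ↔ s = s₀) :
    ∃ s : KuhnCell n, Function.Surjective fun m => ℓ (kuhnVertex s m) := by
  classical
  by_contra! hno
  have hT : {s : KuhnCell n | ∃ m, ℓ₀ (kuhnVertex s m) ≠ ℓ (kuhnVertex s m)}.Finite := by
    have : (Set.univ : Set (Equiv.Perm (Fin (n + 1)) × Fin (n + 2))).Finite := Set.finite_univ
    refine ((hfin.prod this).image fun y : (Fin (n + 1) → ℤ) × Equiv.Perm (Fin (n + 1)) ×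
      Fin (n + 2) => ((fun j => y.1 j - if (y.2.1 j : ℕ) < y.2.2 then 1 else 0, y.2.1) :
        KuhnCell n)).subset ?_
    rintro ⟨v, ρ⟩ ⟨m, hm⟩
    refine ⟨(kuhnVertex (v, ρ) m, ρ, m), ⟨hm, Set.mem_univ _⟩, ?_⟩
    simp [kuhnVertex]
  set T := hT.toFinset with hTdef
  let f : KuhnCell n × Fin (n + 2) → ZMod 2 := fun x =>
    (if KuhnDoor ℓ₀ x then 1 else 0) - if KuhnDoor ℓ x then 1 else 0
  have hfT : ∀ x, f x ≠ 0 → x.1 ∈ T := by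
    intro x hx
    by_contra hxT
    simp only [hTdef, Set.Finite.mem_toFinset, Set.mem_ofPred_eq, not_exists, not_not] at hxT
    have : KuhnDoor ℓ₀ x ↔ KuhnDoor ℓ x := by simp only [KuhnDoor, hxT]
    exact hx (by simp only [f, this, sub_self])
  have hflip : ∀ x, f (kuhnFlip x) = f x := fun x => by simp only [f, kuhnDoor_flip_iff]
  have hsum : ∑ x ∈ T ×ˢ univ, f x = 0 := by
    rw [← Finset.sum_filter_ne_zero]
    refine Finset.sum_involution (fun x _ => kuhnFlip x) ?_ ?_ ?_ ?_
    · intro x _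
      rw [hflip]
      exact CharTwo.add_self_eq_zero _
    · exact fun x _ _ => kuhnFlip_ne x
    · intro x hx
      simp only [mem_filter, mem_product, mem_univ, and_true] at hx ⊢
      have : f (kuhnFlip x) ≠ 0 := by rw [hflip]; exact hx.2
      exact ⟨hfT _ this, this⟩
    · exact fun x _ => kuhnFlip_kuhnFlip x
  rw [Finset.sum_product] at hsum
  simp only [f, Finset.sum_sub_distrib, sum_kuhnDoor, hs₀, hno, if_false, sub_zero,
    Finset.sum_ite_eq'] at hsum
  have hmem : s₀ ∈ T := by
    by_contra hxT
    simp only [hTdef, Set.Finite.mem_toFinset, Set.mem_ofPred_eq, not_exists, not_not] at hxT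
    refine hno s₀ ?_
    have := (hs₀ s₀).2 rfl
    simpa only [hxT] using this
  rw [if_pos hmem] at hsum
  exact one_ne_zero hsum

/-- The least index satisfying `P`, and the last label if there is none. -/
def leastLabel {n : ℕ} (P : Fin n → Prop) [DecidablePred P] : Fin (n + 1) :=
  (univ.filter P).inf Fin.castSucc

lemma leastLabel_le {n : ℕ} {P : Fin n → Prop} [DecidablePred P] {c : Fin n} (h : P c) :
    leastLabel P ≤ c.castSucc :=
  Finset.inf_le (by simp [h])

lemma leastLabel_anti {n : ℕ} {P Q : Fin n → Prop} [DecidablePred P] [DecidablePred Q]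
    (h : ∀ c, P c → Q c) : leastLabel Q ≤ leastLabel P :=
  Finset.inf_mono fun c hc => by
    simp only [mem_filter, mem_univ, true_and] at hc ⊢
    exact h c hc

lemma leastLabel_eq_castSucc {n : ℕ} {P : Fin n → Prop} [DecidablePred P] {c : Fin n}
    (h : leastLabel P = c.castSucc) : P c := by
  by_cases hne : (univ.filter P).Nonempty
  · obtain ⟨c', hc', he⟩ := Finset.exists_mem_eq_inf _ hne (Fin.castSucc (n := n))
    have : c'.castSucc = c.castSucc := by rw [← he]; exact h
    rw [← Fin.castSucc_injective _ this]
    simpa using hc'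
  · rw [Finset.not_nonempty_iff_eq_empty] at hne
    simp only [leastLabel, hne, Finset.inf_empty] at h
    exact absurd h.symm (Fin.castSucc_lt_last c).ne

lemma leastLabel_eq_last {n : ℕ} {P : Fin n → Prop} [DecidablePred P]
    (h : leastLabel P = Fin.last n) (c : Fin n) : ¬ P c := fun hc =>
  absurd (leastLabel_le hc) (by rw [h]; exact (Fin.castSucc_lt_last c).not_ge)

/-- The labelling belonging to the constant map `0` has exactly one simplex with all labels. -/
lemma surjective_leastLabel_pos_iff {n : ℕ} (s : KuhnCell n) :
    (Function.Surjective fun m => leastLabel fun j => 0 < kuhnVertex s m j) ↔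
      s = (0, Fin.revPerm) := by
  constructor
  · intro h
    obtain ⟨v, ρ⟩ := s
    have hinj := Finite.injective_iff_surjective.2 h
    have hanti : ∀ m m' : Fin (n + 2), m ≤ m' →
        leastLabel (fun j => 0 < kuhnVertex (v, ρ) m' j) ≤
          leastLabel fun j => 0 < kuhnVertex (v, ρ) m j := by
      intro m m' hm
      refine leastLabel_anti fun j hj => hj.trans_le ?_
      simp only [kuhnVertex]
      have : (m : ℕ) ≤ m' := hm
      split_ifs <;> omega
    have hrev : ∀ m : Fin (n + 2),
        (leastLabel fun j => 0 < kuhnVertex (v, ρ) m j) = m.rev := by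
      have hmono : StrictMono fun m : Fin (n + 2) =>
          (leastLabel fun j => 0 < kuhnVertex (v, ρ) m j).rev := by
        intro m m' hm
        refine Fin.rev_lt_rev.2 (lt_of_le_of_ne (hanti m m' hm.le) fun he => hm.ne' (hinj he))
      have := hmono.eq_id
      intro m
      rw [← Fin.rev_rev (leastLabel _)]
      exact congrArg Fin.rev (congrFun this m)
    have hj : ∀ j : Fin (n + 1), v j = 0 ∧ ρ j = j.rev := by
      intro j
      have h1 := leastLabel_eq_castSucc ((hrev j.castSucc.rev).trans (Fin.rev_rev _))
      have h2 : ¬ 0 < kuhnVertex (v, ρ) j.succ.rev j := by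
        intro hpos
        have := leastLabel_le (P := fun j => 0 < kuhnVertex (v, ρ) _ j) hpos
        rw [hrev, Fin.rev_rev] at this
        exact absurd this (Fin.castSucc_lt_succ).not_ge
      simp only [kuhnVertex, Fin.val_rev, Fin.val_castSucc, Fin.val_succ] at h1 h2
      have := j.2
      have e : ((ρ j : ℕ) = n - j) ∧ v j = 0 := by
        split_ifs at h1 h2 <;> omega
      refine ⟨e.2, Fin.ext ?_⟩
      rw [Fin.val_rev, e.1]; omega
    refine Prod.ext (funext fun j => (hj j).1) (Equiv.ext fun j => (hj j).2)
  · rintro rfl c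
    refine ⟨c.rev, ?_⟩
    have hiff : ∀ j : Fin (n + 1),
        0 < kuhnVertex ((0, Fin.revPerm) : KuhnCell n) c.rev j ↔ c ≤ j.castSucc := by
      intro j
      have := j.2
      have := c.2
      simp only [kuhnVertex, Pi.zero_apply, Fin.revPerm_apply, Fin.val_rev, Fin.le_def,
        Fin.val_castSucc]
      split_ifs <;> omega
    simp only [hiff]
    refine le_antisymm ?_ (Finset.le_inf fun j hj => by simpa using hj)
    induction c using Fin.lastCases with
    | last => exact Fin.le_last _
    | cast c => exact leastLabel_le le_rfl

lemma exists_fixedPoint_of_support {n : ℕ} {f : (Fin (n + 1) → ℝ) → Fin (n + 1) → ℝ}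
    (hf : Continuous f) {C : ℝ} (hC : ∀ x, ‖f x‖ ≤ C) {R : ℝ} (hR : ∀ x, R ≤ ‖x‖ → f x = 0) :
    ∃ x, f x = x := by
  classical
  let pt : ℕ → (Fin (n + 1) → ℤ) → Fin (n + 1) → ℝ := fun N v j => (v j : ℝ) / (N + 1)
  have hfull : ∀ N : ℕ, ∃ s : KuhnCell n, Function.Surjective fun m =>
      leastLabel fun j => f (pt N (kuhnVertex s m)) j < pt N (kuhnVertex s m) j := by
    intro N
    have hN : (0 : ℝ) < N + 1 := by positivity
    refine exists_surjective_label (fun v => leastLabel fun j => 0 < v j)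
      (fun v => leastLabel fun j => f (pt N v) j < pt N v j) ?_ (0, Fin.revPerm)
      surjective_leastLabel_pos_iff
    refine (Set.finite_Icc (fun _ => -⌈R * (N + 1)⌉) (fun _ => ⌈R * (N + 1)⌉)).subset ?_
    intro v hv
    have hlt : ‖pt N v‖ < R := by
      by_contra! hge
      refine hv ?_
      simp only [hR _ hge, Pi.zero_apply, pt]
      congr 1
      funext j
      simp [div_pos_iff_of_pos_right hN]
    have hj : ∀ j, |(v j : ℝ)| ≤ R * (N + 1) := by
      intro j
      have := (norm_le_pi_norm (pt N v) j).trans hlt.le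
      rwa [Real.norm_eq_abs, abs_div, abs_of_pos hN, div_le_iff₀ hN] at this
    refine ⟨fun j => ?_, fun j => ?_⟩
    · have h := (abs_le.1 (hj j)).1
      have : -(⌈R * (N + 1)⌉ : ℝ) ≤ v j := by linarith [Int.le_ceil (R * (N + 1))]
      exact_mod_cast this
    · have h := (abs_le.1 (hj j)).2
      have : (v j : ℝ) ≤ ⌈R * (N + 1)⌉ := by linarith [Int.le_ceil (R * (N + 1))]
      exact_mod_cast this
  choose s hs using hfull
  have hdist : ∀ N m, ‖pt N (kuhnVertex (s N) m) - pt N (s N).1‖ ≤ 1 / ((N : ℝ) + 1) := by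
    intro N m
    have hN : (0 : ℝ) < N + 1 := by positivity
    refine (pi_norm_le_iff_of_nonneg (by positivity)).2 fun j => ?_
    simp only [pt, kuhnVertex, Pi.sub_apply, Real.norm_eq_abs]
    rw [← sub_div, abs_div, abs_of_pos hN]
    gcongr
    push_cast
    split_ifs <;> simp
  have hdist' : ∀ N m j, |pt N (kuhnVertex (s N) m) j - pt N (s N).1 j| ≤ 1 / ((N : ℝ) + 1) :=
    fun N m j => (norm_le_pi_norm _ j).trans (hdist N m)
  have hupper : ∀ N : ℕ, ∃ m, ∀ j,
      pt N (kuhnVertex (s N) m) j ≤ f (pt N (kuhnVertex (s N) m)) j := by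
    intro N
    obtain ⟨m, hm⟩ := hs N (Fin.last (n + 1))
    exact ⟨m, fun j => not_lt.1 (leastLabel_eq_last hm j)⟩
  have hlower : ∀ (N : ℕ) (j : Fin (n + 1)), ∃ m,
      f (pt N (kuhnVertex (s N) m)) j < pt N (kuhnVertex (s N) m) j := by
    intro N j
    obtain ⟨m, hm⟩ := hs N j.castSucc
    exact ⟨m, leastLabel_eq_castSucc hm⟩
  choose mu hmu using hupper
  choose ml hml using hlower
  have hbdd : ∀ N, pt N (s N).1 ∈ Metric.closedBall (0 : Fin (n + 1) → ℝ) (C + 1) := by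
    intro N
    have hC0 : 0 ≤ C := (norm_nonneg _).trans (hC 0)
    have h1 : 1 / ((N : ℝ) + 1) ≤ 1 := by
      rw [div_le_one (by positivity)]; linarith [(Nat.cast_nonneg N : (0 : ℝ) ≤ N)]
    rw [mem_closedBall_zero_iff]
    refine (pi_norm_le_iff_of_nonneg (by positivity)).2 fun j => ?_
    rw [Real.norm_eq_abs, abs_le]
    have a1 := abs_le.1 (hdist' N (mu N) j)
    have a2 := abs_le.1 (hdist' N (ml N j) j)
    have a3 := abs_le.1 ((norm_le_pi_norm _ j).trans (hC (pt N (kuhnVertex (s N) (mu N)))))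
    have a4 := abs_le.1 ((norm_le_pi_norm _ j).trans (hC (pt N (kuhnVertex (s N) (ml N j)))))
    have a5 := hmu N j
    have a6 := hml N j
    constructor <;> linarith
  obtain ⟨x, -, φ, hφ, hx⟩ := (isCompact_closedBall (0 : Fin (n + 1) → ℝ) (C + 1)).tendsto_subseq
    hbdd
  have hvert : ∀ m : ℕ → Fin (n + 2), Filter.Tendsto
      (fun i => pt (φ i) (kuhnVertex (s (φ i)) (m (φ i)))) Filter.atTop (nhds x) := by
    intro m
    have h0 : Filter.Tendsto (fun i => pt (φ i) (kuhnVertex (s (φ i)) (m (φ i))) -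
        pt (φ i) (s (φ i)).1) Filter.atTop (nhds 0) :=
      squeeze_zero_norm (fun i => hdist (φ i) (m (φ i)))
        (tendsto_one_div_add_atTop_nhds_zero_nat.comp hφ.tendsto_atTop)
    simpa using h0.add hx
  have hcoord : ∀ (m : ℕ → Fin (n + 2)) j, Filter.Tendsto
      (fun i => pt (φ i) (kuhnVertex (s (φ i)) (m (φ i))) j) Filter.atTop (nhds (x j)) :=
    fun m j => (tendsto_pi_nhds.1 (hvert m)) j
  have hfcoord : ∀ (m : ℕ → Fin (n + 2)) j, Filter.Tendsto
      (fun i => f (pt (φ i) (kuhnVertex (s (φ i)) (m (φ i)))) j) Filter.atTop (nhds (f x j)) :=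
    fun m j => (tendsto_pi_nhds.1 ((hf.tendsto x).comp (hvert m))) j
  refine ⟨x, funext fun j => le_antisymm ?_ ?_⟩
  · exact le_of_tendsto_of_tendsto' (hfcoord (fun N => ml N j) j) (hcoord (fun N => ml N j) j)
      fun i => (hml (φ i) j).le
  · exact le_of_tendsto_of_tendsto' (hcoord mu j) (hfcoord mu j) fun i => hmu (φ i) j

/-- **Brouwer's fixed point theorem** for bounded continuous self-maps of `ℝ^(n+1)`. -/
theorem exists_fixedPoint_of_bounded {n : ℕ} {f : (Fin (n + 1) → ℝ) → Fin (n + 1) → ℝ}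
    (hf : Continuous f) {C : ℝ} (hC : ∀ x, ‖f x‖ ≤ C) : ∃ x, f x = x := by
  let χ : (Fin (n + 1) → ℝ) → ℝ := fun x => max 0 (min 1 (C + 1 - ‖x‖))
  have hχ0 : ∀ x, 0 ≤ χ x := fun x => le_max_left _ _
  have hχ1 : ∀ x, χ x ≤ 1 := fun x => max_le zero_le_one (min_le_left _ _)
  have hbound : ∀ x, ‖χ x • f x‖ ≤ C := by
    intro x
    rw [norm_smul, Real.norm_of_nonneg (hχ0 x)]
    exact (mul_le_of_le_one_left (norm_nonneg _) (hχ1 x)).trans (hC x)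
  obtain ⟨x, hx⟩ := exists_fixedPoint_of_support (f := fun x => χ x • f x) (R := C + 1)
    (by fun_prop) hbound (by
      intro x hx
      have : χ x = 0 := max_eq_left ((min_le_right _ _).trans (by linarith))
      simp [this])
  refine ⟨x, ?_⟩
  have hxC : ‖x‖ ≤ C := by
    have := hbound x
    rwa [show χ x • f x = x from hx] at this
  have : χ x = 1 := by
    simp only [χ]
    rw [min_eq_left (by linarith), max_eq_right zero_le_one]
  simpa [this] using hx

/-! ### Time-changed resolvents of sub-generators -/

section Resolvent

variable {ι : Type*} [Fintype ι] [DecidableEq ι]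

/-- `1 - diag(λ) A`, the inverse of the resolvent at `1` of the chain with generator `A`, sped up
by the factor `λ`. -/
def speedMatrix (A : Matrix ι ι ℝ) (lam : ι → ℝ) : Matrix ι ι ℝ := 1 - Matrix.diagonal lam * A

/-- Nonnegative off-diagonal entries and nonpositive row sums. -/
structure IsSubGenerator (A : Matrix ι ι ℝ) : Prop where
  off_nonneg : ∀ i j, i ≠ j → 0 ≤ A i j
  row_nonpos : ∀ i, ∑ j, A i j ≤ 0

lemma speedMatrix_mulVec (A : Matrix ι ι ℝ) (lam x : ι → ℝ) (i : ι) :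
    (speedMatrix A lam).mulVec x i = x i - lam i * ∑ j, A i j * x j := by
  rw [speedMatrix, Matrix.sub_mulVec, Matrix.one_mulVec, ← Matrix.mulVec_mulVec, Pi.sub_apply,
    Matrix.mulVec_diagonal]
  rfl

namespace IsSubGenerator

variable {A : Matrix ι ι ℝ} {lam : ι → ℝ}

lemma nonneg_of_mulVec_nonneg (hA : IsSubGenerator A) (hl : ∀ i, 0 ≤ lam i) {x : ι → ℝ}
    (hx : ∀ i, 0 ≤ (speedMatrix A lam).mulVec x i) (i : ι) : 0 ≤ x i := by
  by_contra! hi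
  obtain ⟨m, -, hm⟩ := Finset.exists_min_image univ x ⟨i, mem_univ i⟩
  have hmneg : x m < 0 := (hm i (mem_univ i)).trans_lt hi
  have h1 : (∑ j, A m j) * x m ≤ ∑ j, A m j * x j := by
    rw [Finset.sum_mul]
    refine Finset.sum_le_sum fun j _ => ?_
    by_cases hj : m = j
    · rw [hj]
    · exact mul_le_mul_of_nonneg_left (hm j (mem_univ j)) (hA.off_nonneg m j hj)
  have h2 : 0 ≤ (∑ j, A m j) * x m := mul_nonneg_of_nonpos_of_nonpos (hA.row_nonpos m) hmneg.le
  have h3 := hx m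
  rw [speedMatrix_mulVec] at h3
  have := mul_nonneg (hl m) (h2.trans h1)
  linarith

lemma det_ne_zero (hA : IsSubGenerator A) (hl : ∀ i, 0 ≤ lam i) : (speedMatrix A lam).det ≠ 0 := by
  intro h
  obtain ⟨x, hx0, hx⟩ := Matrix.exists_mulVec_eq_zero_iff.2 h
  refine hx0 (funext fun i => le_antisymm ?_ ?_)
  · have := hA.nonneg_of_mulVec_nonneg hl (x := -x) (by simp [Matrix.mulVec_neg, hx]) i
    simpa using this
  · exact hA.nonneg_of_mulVec_nonneg hl (by simp [hx]) i

lemma isUnit_det (hA : IsSubGenerator A) (hl : ∀ i, 0 ≤ lam i) : IsUnit (speedMatrix A lam).det :=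
  (hA.det_ne_zero hl).isUnit

lemma inv_nonneg (hA : IsSubGenerator A) (hl : ∀ i, 0 ≤ lam i) (i j : ι) :
    0 ≤ (speedMatrix A lam)⁻¹ i j := by
  refine hA.nonneg_of_mulVec_nonneg hl (x := fun i => (speedMatrix A lam)⁻¹ i j) (fun k => ?_) i
  have : (speedMatrix A lam).mulVec (fun i => (speedMatrix A lam)⁻¹ i j) k =
      (speedMatrix A lam * (speedMatrix A lam)⁻¹) k j := rfl
  rw [this, Matrix.mul_nonsing_inv _ (hA.isUnit_det hl), Matrix.one_apply]
  split_ifs <;> norm_num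

lemma inv_pow_nonneg (hA : IsSubGenerator A) (hl : ∀ i, 0 ≤ lam i) (m : ℕ) (i j : ι) :
    0 ≤ ((speedMatrix A lam)⁻¹ ^ m) i j := by
  induction m generalizing i j with
  | zero => rw [pow_zero, Matrix.one_apply]; split_ifs <;> norm_num
  | succ m ih =>
    rw [pow_succ, Matrix.mul_apply]
    exact Finset.sum_nonneg fun k _ => mul_nonneg (ih i k) (hA.inv_nonneg hl k j)

lemma inv_mul (hA : IsSubGenerator A) (hl : ∀ i, 0 ≤ lam i) :
    (speedMatrix A lam)⁻¹ * speedMatrix A lam = 1 :=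
  Matrix.nonsing_inv_mul _ (hA.isUnit_det hl)

/-- If `N e ≤ c e` then `e ≤ c ^ m N ^ (-m) e`. -/
lemma le_inv_pow_mulVec (hA : IsSubGenerator A) (hl : ∀ i, 0 ≤ lam i) {e : ι → ℝ} {c : ℝ}
    (hc : 0 ≤ c) (he : ∀ i, (speedMatrix A lam).mulVec e i ≤ c * e i) (m : ℕ) (i : ι) :
    e i ≤ c ^ m * ((speedMatrix A lam)⁻¹ ^ m).mulVec e i := by
  induction m generalizing i with
  | zero => simp
  | succ m ih =>
    refine (ih i).trans ?_
    have h1 : ((speedMatrix A lam)⁻¹ ^ m).mulVec e =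
        ((speedMatrix A lam)⁻¹ ^ (m + 1)).mulVec ((speedMatrix A lam).mulVec e) := by
      rw [Matrix.mulVec_mulVec, pow_succ, mul_assoc, hA.inv_mul hl, mul_one]
    have h2 : ((speedMatrix A lam)⁻¹ ^ m).mulVec e i ≤
        c * ((speedMatrix A lam)⁻¹ ^ (m + 1)).mulVec e i := by
      rw [h1, Matrix.mulVec, Matrix.mulVec, dotProduct, dotProduct, Finset.mul_sum]
      refine Finset.sum_le_sum fun j _ => ?_
      rw [mul_left_comm]
      exact mul_le_mul_of_nonneg_left (he j) (hA.inv_pow_nonneg hl _ i j)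
    rw [pow_succ, mul_assoc]
    exact mul_le_mul_of_nonneg_left h2 (pow_nonneg hc m)

lemma sum_inv_pow_mul (hA : IsSubGenerator A) (hl : ∀ i, 0 ≤ lam i) (r : ℕ) :
    (∑ m ∈ range r, (speedMatrix A lam)⁻¹ ^ (m + 1)) * (Matrix.diagonal lam * A) =
      (speedMatrix A lam)⁻¹ ^ r - 1 := by
  rw [← geom_sum_mul, Finset.sum_mul, Finset.sum_mul]
  refine Finset.sum_congr rfl fun m _ => ?_
  have h : Matrix.diagonal lam * A = 1 - speedMatrix A lam := by rw [speedMatrix, sub_sub_cancel]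
  rw [h, pow_succ, mul_assoc, mul_sub, mul_one, hA.inv_mul hl]

end IsSubGenerator

/-- A chain with sub-generator `A` started in `ν` can be sped up by some `λ` in such a way that,
at an independent gamma time with integer shape `r`, its law is `ν + W A`. -/
theorem exists_speed {n : ℕ} {A : Matrix (Fin (n + 1)) (Fin (n + 1)) ℝ} (hA : IsSubGenerator A)
    {ν W : Fin (n + 1) → ℝ} (hν : ∀ j, 0 ≤ ν j) (hW : ∀ j, 0 ≤ W j)
    (hp : ∀ j, W j ≠ 0 → 0 < (ν + Matrix.vecMul W A) j) {r : ℕ} (hr : 1 ≤ r) :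
    ∃ lam : Fin (n + 1) → ℝ, (∀ j, 0 ≤ lam j) ∧ (∀ j, W j = 0 → lam j = 0) ∧
      Matrix.vecMul ν ((speedMatrix A lam)⁻¹ ^ r) = ν + Matrix.vecMul W A := by
  classical
  set p := ν + Matrix.vecMul W A with hpdef
  let q : Fin (n + 1) → ℝ := fun j => if W j = 0 then 1 else p j
  have hq : ∀ j, 0 < q j := by
    intro j
    by_cases h : W j = 0
    · simp [q, h]
    · simpa [q, h] using hp j h
  let S : (Fin (n + 1) → ℝ) → Fin (n + 1) → ℝ := fun lam =>
    Matrix.vecMul ν (∑ m ∈ range r, (speedMatrix A lam)⁻¹ ^ (m + 1))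
  let T : (Fin (n + 1) → ℝ) → Fin (n + 1) → ℝ := fun x j =>
    W j / max (S (fun i => max (x i) 0) j) (q j)
  have hmax : ∀ x j, 0 < max (S x j) (q j) := fun x j => (hq j).trans_le (le_max_right _ _)
  have hTcont : Continuous T := by
    have hN : Continuous fun x : Fin (n + 1) → ℝ => speedMatrix A fun i => max (x i) 0 :=
      continuous_const.sub ((Continuous.matrix_diagonal (continuous_pi fun i =>
        (continuous_apply i).max continuous_const)).mul continuous_const)
    have hinv : Continuous fun x : Fin (n + 1) → ℝ =>
        (speedMatrix A fun i => max (x i) 0)⁻¹ := by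
      simp only [Matrix.inv_def, Ring.inverse_eq_inv']
      exact (hN.matrix_det.inv₀ fun x => hA.det_ne_zero fun i => le_max_right _ _).smul
        hN.matrix_adjugate
    refine continuous_pi fun j => continuous_const.div (Continuous.max ?_ continuous_const)
      fun x => (hmax _ _).ne'
    have hS : Continuous fun x : Fin (n + 1) → ℝ => S fun i => max (x i) 0 :=
      Continuous.matrix_vecMul continuous_const (continuous_finsetSum _ fun m _ => hinv.pow _)
    exact (continuous_apply j).comp hS
  have hT0 : ∀ x j, 0 ≤ T x j := fun x j => div_nonneg (hW j) (hmax _ _).le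
  have hTle : ∀ x, ‖T x‖ ≤ ∑ j, W j / q j := by
    intro x
    refine (pi_norm_le_iff_of_nonneg
      (Finset.sum_nonneg fun j _ => div_nonneg (hW j) (hq j).le)).2 fun j => ?_
    rw [Real.norm_of_nonneg (hT0 x j)]
    exact (div_le_div_of_nonneg_left (hW j) (hq j) (le_max_right _ _)).trans
      (Finset.single_le_sum (f := fun j => W j / q j)
        (fun j _ => div_nonneg (hW j) (hq j).le) (mem_univ j))
  obtain ⟨lam, hlam⟩ := exists_fixedPoint_of_bounded hTcont hTle
  have hl : ∀ j, 0 ≤ lam j := fun j => by rw [← hlam]; exact hT0 _ j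
  have hpos : (fun i => max (lam i) 0) = lam := funext fun i => max_eq_left (hl i)
  have hfix : ∀ j, lam j * max (S lam j) (q j) = W j := by
    intro j
    have h := congrFun hlam j
    simp only [T, hpos] at h
    rw [← h, div_mul_cancel₀ _ (hmax _ _).ne']
  have hl0 : ∀ j, W j = 0 → lam j = 0 := by
    intro j hj
    have h := hfix j
    rw [hj] at h
    exact (mul_eq_zero.1 h).resolve_right (hmax _ _).ne'
  refine ⟨lam, hl, hl0, ?_⟩
  set B := (speedMatrix A lam)⁻¹ with hB
  -- `δ` is the part of `W` not yet used up; it lives where `S` lies below the target.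
  let δ : Fin (n + 1) → ℝ := fun j => W j - S lam j * lam j
  have hlaw : Matrix.vecMul ν (B ^ r) = p - Matrix.vecMul δ A := by
    have h1 : Matrix.vecMul (S lam) (Matrix.diagonal lam * A) = Matrix.vecMul ν (B ^ r) - ν := by
      simp only [S]
      rw [Matrix.vecMul_vecMul, hA.sum_inv_pow_mul hl, Matrix.vecMul_sub, Matrix.vecMul_one]
    have h2 : δ = W - Matrix.vecMul (S lam) (Matrix.diagonal lam) := by
      funext j
      simp [δ, Matrix.vecMul_diagonal]
    rw [h2, Matrix.sub_vecMul, Matrix.vecMul_vecMul, h1, hpdef]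
    abel
  have hδ0 : ∀ j, 0 ≤ δ j := by
    intro j
    have := mul_le_mul_of_nonneg_left (le_max_left (S lam j) (q j)) (hl j)
    rw [hfix] at this
    simp only [δ]
    linarith
  have hδS : ∀ j, δ j ≠ 0 → S lam j < p j := by
    intro j hj
    have hWj : W j ≠ 0 := fun h => hj (by simp [δ, h, hl0 j h])
    by_contra! hge
    have hqj : q j = p j := by simp [q, hWj]
    refine hj ?_
    have := hfix j
    rw [hqj, max_eq_left hge] at this
    simp only [δ]
    linarith
  have hBS : ∀ j, Matrix.vecMul ν (B ^ r) j ≤ S lam j := by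
    intro j
    have h1 : S lam j = ∑ m ∈ range r, Matrix.vecMul ν (B ^ (m + 1)) j := by
      simp only [S]
      rw [Matrix.vecMul_sum, Finset.sum_apply]
    rw [h1]
    have h0 : ∀ m, 0 ≤ Matrix.vecMul ν (B ^ (m + 1)) j := fun m => by
      rw [Matrix.vecMul, dotProduct]
      exact Finset.sum_nonneg fun i _ => mul_nonneg (hν i) (hA.inv_pow_nonneg hl _ i j)
    have h2 := Finset.single_le_sum (f := fun m => Matrix.vecMul ν (B ^ (m + 1)) j)
      (fun m _ => h0 m) (mem_range.2 (by omega : r - 1 < r))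
    simpa only [Nat.sub_add_cancel hr] using h2
  have hδA : ∀ j, δ j ≠ 0 → 0 < Matrix.vecMul δ A j := by
    intro j hj
    have h := (hBS j).trans_lt (hδS j hj)
    rw [hlaw, Pi.sub_apply] at h
    linarith
  have hδ : δ = 0 := by
    by_contra hne
    obtain ⟨j₀, hj₀⟩ := Function.ne_iff.1 hne
    have hsum : 0 < ∑ j ∈ univ.filter (fun j => δ j ≠ 0), Matrix.vecMul δ A j :=
      Finset.sum_pos (fun j hj => hδA j (mem_filter.1 hj).2) ⟨j₀, by simpa using hj₀⟩
    have hle : ∑ j ∈ univ.filter (fun j => δ j ≠ 0), Matrix.vecMul δ A j ≤ 0 := by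
      simp only [Matrix.vecMul, dotProduct]
      rw [Finset.sum_comm]
      refine Finset.sum_nonpos fun i _ => ?_
      rw [← Finset.mul_sum]
      by_cases hi : δ i = 0
      · rw [hi, zero_mul]
      · refine mul_nonpos_of_nonneg_of_nonpos (hδ0 i) (le_trans ?_ (hA.row_nonpos i))
        refine Finset.sum_le_sum_of_subset_of_nonneg (subset_univ _) fun j _ hj => ?_
        refine hA.off_nonneg i j fun h => hj ?_
        simpa [← h] using hi
    exact absurd hsum hle.not_gt
  rw [hlaw, hδ, Matrix.zero_vecMul, sub_zero]

end Resolvent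

/-! ### Sweeping a distribution to two adjacent nodes -/

lemma exists_sweep (p kt u d : ℕ → ℝ) (hp : ∀ n, 0 < p n) (hkt : ∀ n, 0 ≤ kt n)
    (hu : ∀ n, 0 ≤ u n) (hd : ∀ n, 0 < d n) :
    ∃ L Φ : ℕ → ℝ, L 0 = 0 ∧ Φ 0 = p 0 ∧ (∀ n, 0 < L (n + 1)) ∧
      (∀ n, L (n + 1) * d (n + 1) = Φ n + L n * u n) ∧
      ∀ n, Φ (n + 1) = Φ n + p (n + 1) + L (n + 1) * kt (n + 1) := by
  let f : ℕ → ℝ × ℝ := fun n => Nat.rec (0, p 0) (fun n y =>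
    ((y.2 + y.1 * u n) / d (n + 1),
      y.2 + p (n + 1) + (y.2 + y.1 * u n) / d (n + 1) * kt (n + 1))) n
  have hpos : ∀ n, 0 ≤ (f n).1 ∧ 0 < (f n).2 := by
    intro n
    induction n with
    | zero => exact ⟨le_rfl, hp 0⟩
    | succ n ih =>
      have h1 : 0 ≤ ((f n).2 + (f n).1 * u n) / d (n + 1) :=
        div_nonneg (add_nonneg ih.2.le (mul_nonneg ih.1 (hu n))) (hd _).le
      exact ⟨h1, add_pos_of_pos_of_nonneg (add_pos ih.2 (hp _)) (mul_nonneg h1 (hkt _))⟩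
  refine ⟨fun n => (f n).1, fun n => (f n).2, rfl, rfl, fun n => ?_, fun n => ?_, fun n => rfl⟩
  · exact div_pos (add_pos_of_pos_of_nonneg (hpos n).2 (mul_nonneg (hpos n).1 (hu n))) (hd _)
  · exact div_mul_cancel₀ _ (hd _).ne'

/-- A positive vector `P` on the nodes `1, …, M` is reached from a measure on two adjacent nodes
by a birth-death chain with killing; `W j` is the expected number of jumps out of `j`. -/
lemma exists_balayage {M : ℕ} (hM : 2 ≤ M) (P kt u d : ℕ → ℝ) (hP : ∀ n, 0 < P n)
    (hkt : ∀ n, 0 ≤ kt n) (hu : ∀ n, 0 < u n) (hd : ∀ n, 0 < d n)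
    (hud : ∀ j, 2 ≤ j → j ≤ M - 1 → u j + d j = 1) :
    ∃ (l : ℕ) (W : ℕ → ℝ) (x y : ℝ), 2 ≤ l ∧ l ≤ M ∧ 0 ≤ x ∧ 0 < y ∧
      (∀ j, 0 ≤ W j) ∧ (∀ j, ¬(2 ≤ j ∧ j ≤ M - 1) → W j = 0) ∧
      ∀ c, 1 ≤ c → c ≤ M → (if c = l - 1 then x else 0) + (if c = l then y else 0) +
        (W (c - 1) * u (c - 1) + W (c + 1) * d (c + 1) - W c * (1 + kt c)) = P c := by
  obtain ⟨L, Φ, hL0, hΦ0, hLpos, hL, hΦ⟩ := exists_sweep (fun n => P (n + 1))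
    (fun n => kt (n + 1)) (fun n => u (n + 1)) (fun n => d (n + 1)) (fun n => hP _)
    (fun n => hkt _) (fun n => (hu _).le) (fun n => hd _)
  obtain ⟨R, Ψ, hR0, hΨ0, hRpos, hR, hΨ⟩ := exists_sweep (fun n => P (M - n))
    (fun n => kt (M - n)) (fun n => d (M - n)) (fun n => u (M - n)) (fun n => hP _)
    (fun n => hkt _) (fun n => (hd _).le) (fun n => hu _)
  have hLnn : ∀ n, 0 ≤ L n := fun n => by cases n; exacts [hL0.ge, (hLpos _).le]
  have hRnn : ∀ n, 0 ≤ R n := fun n => by cases n; exacts [hR0.ge, (hRpos _).le]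
  have hL' : ∀ j, 1 ≤ j → L j * d (j + 1) = Φ (j - 1) + L (j - 1) * u j := by
    intro j hj
    obtain ⟨n, rfl⟩ := Nat.exists_eq_add_of_le' hj
    exact hL n
  have hΦ' : ∀ j, 2 ≤ j → Φ (j - 1) = Φ (j - 2) + P j + L (j - 1) * kt j := by
    intro j hj
    obtain ⟨n, rfl⟩ := Nat.exists_eq_add_of_le' hj
    exact hΦ n
  have hR' : ∀ j, j < M → R (M - j) * u j = Ψ (M - (j + 1)) + R (M - (j + 1)) * d (j + 1) := by
    intro j hj
    have h := hR (M - (j + 1))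
    rwa [show M - (j + 1) + 1 = M - j by omega, show M - (M - j) = j by omega,
      show M - (M - (j + 1)) = j + 1 by omega] at h
  have hΨ' : ∀ j, j < M → Ψ (M - j) = Ψ (M - (j + 1)) + P j + R (M - j) * kt j := by
    intro j hj
    have h := hΨ (M - (j + 1))
    rwa [show M - (j + 1) + 1 = M - j by omega, show M - (M - j) = j by omega] at h
  have hex : ∃ j, 1 ≤ j ∧ R (M - j) ≤ L (j - 1) :=
    ⟨M, by omega, by rw [Nat.sub_self, hR0]; exact hLnn _⟩
  classical
  obtain ⟨hl1, hl⟩ := Nat.find_spec hex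
  have hmin : ∀ j, j < Nat.find hex → ¬(1 ≤ j ∧ R (M - j) ≤ L (j - 1)) :=
    fun j hj => Nat.find_min hex hj
  have hlM : Nat.find hex ≤ M :=
    Nat.find_min' hex ⟨by omega, by rw [Nat.sub_self, hR0]; exact hLnn _⟩
  generalize Nat.find hex = l at hl1 hl hmin hlM
  have hl2 : 2 ≤ l := by
    by_contra! h
    obtain rfl : l = 1 := by omega
    have := hRpos (M - 2)
    rw [show M - 2 + 1 = M - 1 by omega] at this
    rw [show 1 - 1 = 0 from rfl, hL0] at hl
    linarith
  have hlt : L (l - 2) < R (M - (l - 1)) := by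
    have := hmin (l - 1) (by omega)
    rw [not_and, not_le] at this
    exact this (by omega)
  let W : ℕ → ℝ := fun j =>
    if 2 ≤ j ∧ j ≤ M - 1 then if j < l then L (j - 1) else R (M - j) else 0
  have hWout : ∀ j, ¬(2 ≤ j ∧ j ≤ M - 1) → W j = 0 := fun j hj => if_neg hj
  have hWL : ∀ j, 1 ≤ j → j < l → W j = L (j - 1) := by
    intro j hj hjl
    by_cases h : 2 ≤ j ∧ j ≤ M - 1
    · simp only [W, if_pos h, if_pos hjl]
    · obtain rfl : j = 1 := by omega
      rw [hWout _ h]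
      exact hL0.symm
  have hWR : ∀ j, l ≤ j → j ≤ M → W j = R (M - j) := by
    intro j hj hjM
    by_cases h : 2 ≤ j ∧ j ≤ M - 1
    · simp only [W, if_pos h, if_neg hj.not_gt]
    · obtain rfl : j = M := by omega
      rw [hWout _ h, Nat.sub_self, hR0]
  have hleft : ∀ c, 1 ≤ c → c < l →
      W (c - 1) * u (c - 1) + L c * d (c + 1) - W c * (1 + kt c) = P c := by
    intro c hc hcl
    rw [hWL c hc hcl]
    by_cases h1 : c = 1
    · subst h1
      have h := hL' 1 le_rfl
      simp only [Nat.sub_self, hL0, hΦ0] at h ⊢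
      rw [h, hWout 0 (by omega)]
      ring
    · have h := hL' c hc
      have h' := hL' (c - 1) (by omega)
      rw [show c - 1 + 1 = c by omega, show c - 1 - 1 = c - 2 by omega] at h'
      have h'' := hΦ' c (by omega)
      have hs := hud c (by omega) (by omega)
      rw [hWL (c - 1) (by omega) (by omega), show c - 1 - 1 = c - 2 by omega]
      linear_combination h - h' + h'' + L (c - 1) * hs
  have hright : ∀ c, l ≤ c → c ≤ M →
      R (M - (c - 1)) * u (c - 1) + W (c + 1) * d (c + 1) - W c * (1 + kt c) = P c := by
    intro c hc hcM
    rw [hWR c hc hcM]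
    have h := hR' (c - 1) (by omega)
    rw [show c - 1 + 1 = c by omega] at h
    by_cases h1 : c = M
    · subst h1
      simp only [Nat.sub_self, hR0, hΨ0, Nat.sub_zero] at h ⊢
      rw [h, hWout (c + 1) (by omega)]
      ring
    · have h' := hR' c (by omega)
      have h'' := hΨ' c (by omega)
      have hs := hud c (by omega) (by omega)
      rw [hWR (c + 1) (by omega) (by omega)]
      linear_combination h - h' + h'' + R (M - c) * hs
  refine ⟨l, W, d l * (L (l - 1) - R (M - l)), u (l - 1) * (R (M - (l - 1)) - L (l - 2)),
    hl2, hlM, mul_nonneg (hd _).le (sub_nonneg.2 hl), mul_pos (hu _) (sub_pos.2 hlt), ?_, hWout, ?_⟩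
  · intro j
    simp only [W]
    split_ifs
    exacts [hLnn _, hRnn _, le_rfl]
  · intro c hc hcM
    rcases lt_trichotomy c (l - 1) with h | h | h
    · rw [if_neg h.ne, if_neg (by omega), hWL (c + 1) (by omega) (by omega), add_tsub_cancel_right]
      linarith [hleft c hc (by omega)]
    · have e := hleft c hc (by omega)
      rw [if_pos h, if_neg (by omega), hWR (c + 1) (by omega) (by omega)]
      obtain rfl : l = c + 1 := by omega
      rw [add_tsub_cancel_right]
      linear_combination e
    · by_cases hcl : c = l
      · subst hcl
        have e := hright c le_rfl hcM
        rw [if_neg (by omega), if_pos rfl, hWL (c - 1) (by omega) (by omega),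
          show c - 1 - 1 = c - 2 by omega]
        linear_combination e
      · have e := hright c (by omega) hcM
        rw [if_neg (by omega), if_neg hcl, hWR (c - 1) (by omega) (by omega)]
        linear_combination e

/-! ### The birth-death generator -/

lemma fid_val {M j : ℕ} (h : j ≤ M + 1) : (fid M j).1 = j - 1 :=
  Nat.mod_eq_of_lt (by omega)

lemma fid_eq_iff {M j : ℕ} (h1 : 1 ≤ j) (h : j ≤ M + 1) (v : Fin (M + 1)) :
    v = fid M j ↔ v.1 + 1 = j := by
  rw [Fin.ext_iff, fid_val h]
  omega

section Generator

variable {M : ℕ} {i b k : ℕ → ℝ}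

lemma grid_lt (hi : ∀ j, 1 ≤ j → j ≤ M - 1 → i j < i (j + 1)) {j : ℕ} (h2 : 2 ≤ j)
    (hj : j ≤ M - 1) : i (j - 1) < i j ∧ i j < i (j + 1) := by
  refine ⟨?_, hi j (by omega) hj⟩
  have := hi (j - 1) (by omega) (by omega)
  rwa [Nat.sub_add_cancel (by omega)] at this

lemma qup_pos (hi : ∀ j, 1 ≤ j → j ≤ M - 1 → i j < i (j + 1)) (hb : DriftHyp M i b) {j : ℕ}
    (h2 : 2 ≤ j) (hj : j ≤ M - 1) : 0 < qup i b j := by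
  obtain ⟨h, h'⟩ := grid_lt hi h2 hj
  have hd : 0 < i (j + 1) - i j := sub_pos.2 h'
  refine mul_pos (div_pos (by linarith) (by linarith)) ?_
  have := mul_lt_mul_of_pos_left (hb j h2 hj).1 hd
  rw [mul_neg, mul_one_div_cancel hd.ne'] at this
  linarith

lemma qdn_pos (hi : ∀ j, 1 ≤ j → j ≤ M - 1 → i j < i (j + 1)) (hb : DriftHyp M i b) {j : ℕ}
    (h2 : 2 ≤ j) (hj : j ≤ M - 1) : 0 < qdn i b j := by
  obtain ⟨h, h'⟩ := grid_lt hi h2 hj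
  have hd : 0 < i j - i (j - 1) := sub_pos.2 h
  refine mul_pos (div_pos (by linarith) (by linarith)) ?_
  have := mul_lt_mul_of_pos_left (hb j h2 hj).2 hd
  rw [mul_one_div_cancel hd.ne'] at this
  linarith

lemma qup_add_qdn (hi : ∀ j, 1 ≤ j → j ≤ M - 1 → i j < i (j + 1)) {j : ℕ}
    (h2 : 2 ≤ j) (hj : j ≤ M - 1) : qup i b j + qdn i b j = 1 := by
  obtain ⟨h, h'⟩ := grid_lt hi h2 hj
  have hd : i (j + 1) - i (j - 1) ≠ 0 := by linarith
  unfold qup qdn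
  field_simp
  ring

lemma ktil_nonneg (hi : ∀ j, 1 ≤ j → j ≤ M - 1 → i j < i (j + 1))
    (hk : ∀ j, 2 ≤ j → j ≤ M - 1 → 0 ≤ k j) (j : ℕ) : 0 ≤ ktil M i k j := by
  unfold ktil
  split_ifs with h
  · obtain ⟨h3, h4⟩ := grid_lt hi h.1 h.2
    exact mul_nonneg (mul_nonneg (by linarith) (by linarith)) (hk j h.1 h.2)
  · exact le_rfl

lemma ThE_one_of_mem {j : ℕ} (h2 : 2 ≤ j) (hj : j ≤ M - 1) (c : ℕ) :
    ThE M i b k (fun _ => 1) j c =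
      (if c = j + 1 then qup i b j else 0) + (if c = j - 1 then qdn i b j else 0) +
        (if c = M + 1 then ktil M i k j else 0) - (if c = j then 1 + ktil M i k j else 0) := by
  unfold ThE
  rw [if_pos ⟨h2, hj⟩]
  split_ifs <;> first | omega | ring

lemma ThE_of_notMem {lam : ℕ → ℝ} {j : ℕ} (h : ¬(2 ≤ j ∧ j ≤ M - 1)) (c : ℕ) :
    ThE M i b k lam j c = 0 :=
  if_neg h

lemma sum_ThE (hi : ∀ j, 1 ≤ j → j ≤ M - 1 → i j < i (j + 1)) (j : ℕ) :
    ∑ v : Fin (M + 1), ThE M i b k (fun _ => 1) j (v.1 + 1) = 0 := by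
  by_cases h : 2 ≤ j ∧ j ≤ M - 1
  · rw [Fin.sum_univ_eq_sum_range (fun v => ThE M i b k (fun _ => 1) j (v + 1)) (M + 1)]
    have hq := qup_add_qdn (b := b) hi h.1 h.2
    have e1 : ∀ v, v + 1 = j - 1 ↔ v = j - 2 := by omega
    have e2 : ∀ v, v + 1 = j ↔ v = j - 1 := by omega
    simp only [ThE_one_of_mem h.1 h.2, Finset.sum_add_distrib, Finset.sum_sub_distrib,
      add_left_inj, e1, e2, Finset.sum_ite_eq', Finset.mem_range]
    rw [if_pos (by omega), if_pos (by omega), if_pos (by omega), if_pos (by omega)]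
    linarith
  · exact Finset.sum_eq_zero fun v _ => ThE_of_notMem h _

lemma ThE_cemetery (j : ℕ) : ThE M i b k (fun _ => 1) j (M + 1) = ktil M i k j := by
  by_cases h : 2 ≤ j ∧ j ≤ M - 1
  · rw [ThE_one_of_mem h.1 h.2, if_neg (by omega), if_neg (by omega), if_pos rfl,
      if_neg (by omega)]
    ring
  · rw [ThE_of_notMem h, ktil, if_neg h]

lemma isSubGenerator_Theta (hi : ∀ j, 1 ≤ j → j ≤ M - 1 → i j < i (j + 1))
    (hb : DriftHyp M i b) (hk : ∀ j, 2 ≤ j → j ≤ M - 1 → 0 ≤ k j) :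
    IsSubGenerator (Theta M i b k fun _ => 1) where
  off_nonneg u v huv := by
    have huv' : v.1 + 1 ≠ u.1 + 1 := fun h => huv (Fin.ext (by omega))
    change 0 ≤ ThE M i b k (fun _ => 1) (u.1 + 1) (v.1 + 1)
    by_cases h : 2 ≤ u.1 + 1 ∧ u.1 + 1 ≤ M - 1
    · rw [ThE_one_of_mem h.1 h.2, if_neg huv', sub_zero]
      have h1 := (qup_pos hi hb h.1 h.2).le
      have h2 := (qdn_pos hi hb h.1 h.2).le
      have h3 := ktil_nonneg hi hk (u.1 + 1)
      refine add_nonneg (add_nonneg ?_ ?_) ?_ <;> split_ifs <;> first | assumption | exact le_rfl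
    · exact (ThE_of_notMem h _).ge
  row_nonpos u := (sum_ThE hi _).le

/-- The rate at which `W` feeds the node `c`. -/
lemma sum_mul_ThE {W : ℕ → ℝ} (hW : ∀ j, ¬(2 ≤ j ∧ j ≤ M - 1) → W j = 0) {c : ℕ} (h1 : 1 ≤ c)
    (hc : c ≤ M) :
    ∑ u : Fin (M + 1), W (u.1 + 1) * ThE M i b k (fun _ => 1) (u.1 + 1) c =
      W (c - 1) * qup i b (c - 1) + W (c + 1) * qdn i b (c + 1) -
        W c * (1 + ktil M i k c) := by
  have key : ∀ j, W j * ThE M i b k (fun _ => 1) j c =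
      (if j = c - 1 then W j * qup i b j else 0) + (if j = c + 1 then W j * qdn i b j else 0) -
        (if j = c then W j * (1 + ktil M i k j) else 0) := by
    intro j
    by_cases h : 2 ≤ j ∧ j ≤ M - 1
    · rw [ThE_one_of_mem h.1 h.2, if_neg (show c ≠ M + 1 by omega)]
      split_ifs <;> first | omega | ring
    · simp [hW j h]
  have h0 : W 0 * ThE M i b k (fun _ => 1) 0 c = 0 := by rw [hW 0 (by omega), zero_mul]
  rw [Fin.sum_univ_eq_sum_range (fun u => W (u + 1) * ThE M i b k (fun _ => 1) (u + 1) c) (M + 1),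
    ← add_zero (∑ u ∈ Finset.range (M + 1), _), ← h0,
    ← Finset.sum_range_succ' (fun j => W j * ThE M i b k (fun _ => 1) j c) (M + 1)]
  simp only [key, Finset.sum_add_distrib, Finset.sum_sub_distrib, Finset.sum_ite_eq',
    Finset.mem_range]
  rw [if_pos (by omega), if_pos (by omega), if_pos (by omega)]

lemma Theta_mulVec_alive (hi : ∀ j, 1 ≤ j → j ≤ M - 1 → i j < i (j + 1)) (u : Fin (M + 1)) :
    ∑ v, Theta M i b k (fun _ => 1) u v * (if v.1 = M then 0 else 1) = -ktil M i k (u.1 + 1) := by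
  have h := sum_ThE (b := b) (k := k) hi (u.1 + 1)
  rw [Fin.sum_univ_castSucc] at h
  rw [Fin.sum_univ_castSucc]
  simp only [Fin.val_last, ThE_cemetery, Fin.val_castSucc] at h
  have e : ∀ v : Fin M, Theta M i b k (fun _ => 1) u v.castSucc *
      (if v.castSucc.1 = M then 0 else 1) = ThE M i b k (fun _ => 1) (u.1 + 1) (v.1 + 1) := by
    intro v
    rw [if_neg (by simp [v.2.ne]), mul_one]
    rfl
  simp only [e, Fin.val_last, if_true, mul_zero, add_zero]
  linarith

lemma Ptilde_eq (h : ℝ) (lam : ℕ → ℝ) :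
    Ptilde M h i b k lam =
      1 + h • (Matrix.diagonal (fun u : Fin (M + 1) => lam (u.1 + 1)) *
        Theta M i b k fun _ => 1) := by
  ext u v
  rw [Matrix.add_apply, Matrix.smul_apply, Matrix.diagonal_mul, Matrix.one_apply, smul_eq_mul]
  change PtE M h i b k lam (u.1 + 1) (v.1 + 1) =
    _ + h * (lam (u.1 + 1) * ThE M i b k (fun _ => 1) (u.1 + 1) (v.1 + 1))
  have huv : u = v ↔ v.1 + 1 = u.1 + 1 := by rw [Fin.ext_iff]; omega
  simp only [huv]
  unfold PtE ThE
  split_ifs <;> first | omega | ring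

lemma one_sub_smul_Ptilde {a h s : ℝ} (has : (1 - a) * s = a * h) (lam : ℕ → ℝ) :
    1 - a • Ptilde M h i b k lam =
      (1 - a) • speedMatrix (Theta M i b k fun _ => 1)
        (fun u : Fin (M + 1) => s * lam (u.1 + 1)) := by
  rw [Ptilde_eq]
  ext u v
  simp only [speedMatrix, Matrix.sub_apply, Matrix.add_apply, Matrix.smul_apply,
    Matrix.diagonal_mul, smul_eq_mul]
  linear_combination
    lam (u.1 + 1) * Theta M i b k (fun _ => 1) u v * has

end Generator

lemma inv_smul_pow {n : Type*} [Fintype n] [DecidableEq n] {c : ℝ} (hc : c ≠ 0)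
    {N : Matrix n n ℝ} (hN : IsUnit N.det) (r : ℕ) :
    c ^ r • (c • N)⁻¹ ^ r = N⁻¹ ^ r := by
  have h : (c • N)⁻¹ = c⁻¹ • N⁻¹ := by
    refine Matrix.inv_eq_right_inv ?_
    rw [smul_mul_smul_comm, mul_inv_cancel₀ hc, Matrix.mul_nonsing_inv _ hN, one_smul]
  rw [h, smul_pow, smul_smul, ← mul_pow, mul_inv_cancel₀ hc, one_pow, one_smul]

/-- A probability vector charging all nodes is, up to the mass lost to killing, the law of the
birth-death chain with a suitable speed at a gamma-type time with integer shape. -/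
lemma exists_intensity {M : ℕ} (hM : 3 ≤ M) {i b k p : ℕ → ℝ} {s : ℝ} (hs : 0 < s)
    {r : ℕ} (hr : 1 ≤ r) (hi : ∀ j, 1 ≤ j → j ≤ M - 1 → i j < i (j + 1))
    (hb : DriftHyp M i b) (hk : ∀ j, 2 ≤ j → j ≤ M - 1 → 0 ≤ k j) (hp : ProbVec M p) :
    ∃ (l : ℕ) (lam : ℕ → ℝ) (x y : ℝ), 2 ≤ l ∧ l ≤ M ∧ IntensityVec M lam ∧ 0 ≤ x ∧ 0 < y ∧
      1 ≤ x + y ∧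
      (∀ K, 0 ≤ K → (∀ j, 2 ≤ j → j ≤ M - 1 → ktil M i k j * lam j ≤ K) →
        x + y ≤ (1 + s * K) ^ r) ∧
      IsUnit (speedMatrix (Theta M i b k fun _ => 1)
        (fun u : Fin (M + 1) => s * lam (u.1 + 1))).det ∧
      ∀ j, 1 ≤ j → j ≤ M →
        x * ((speedMatrix (Theta M i b k fun _ => 1)
            (fun u : Fin (M + 1) => s * lam (u.1 + 1)))⁻¹ ^ r) (fid M (l - 1)) (fid M j) +
          y * ((speedMatrix (Theta M i b k fun _ => 1)
            (fun u : Fin (M + 1) => s * lam (u.1 + 1)))⁻¹ ^ r) (fid M l) (fid M j) = p j := by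
  set A := Theta M i b k fun _ => 1
  have hA : IsSubGenerator A := isSubGenerator_Theta hi hb hk
  have hkt := ktil_nonneg hi hk
  obtain ⟨l, W, x, y, hl2, hlM, hx, hy, hW, hW0, hbal⟩ :=
    exists_balayage (M := M) (by omega) (fun j => if 1 ≤ j ∧ j ≤ M then p j else 1) (ktil M i k)
      (fun j => if 2 ≤ j ∧ j ≤ M - 1 then qup i b j else 1)
      (fun j => if 2 ≤ j ∧ j ≤ M - 1 then qdn i b j else 1)
      (fun j => by
        split_ifs with h
        · exact hp.1 j h.1 h.2
        · exact one_pos) hkt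
      (fun j => by
        split_ifs with h
        · exact qup_pos hi hb h.1 h.2
        · exact one_pos)
      (fun j => by
        split_ifs with h
        · exact qdn_pos hi hb h.1 h.2
        · exact one_pos)
      (fun j h2 hj => by simpa only [h2, hj, and_self, if_true] using qup_add_qdn hi h2 hj)
  have hWu : ∀ (q : ℕ → ℝ) j, W j * (if 2 ≤ j ∧ j ≤ M - 1 then q j else 1) = W j * q j := by
    intro q j
    split_ifs with h
    · rfl
    · rw [hW0 j h, zero_mul, zero_mul]
  let ν : Fin (M + 1) → ℝ := fun v =>
    (if v.1 + 1 = l - 1 then x else 0) + (if v.1 + 1 = l then y else 0)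
  let w : Fin (M + 1) → ℝ := fun v => W (v.1 + 1)
  let e : Fin (M + 1) → ℝ := fun v => if v.1 = M then 0 else 1
  have hν : ∀ v, 0 ≤ ν v := fun v =>
    add_nonneg (by split_ifs <;> first | assumption | exact le_rfl)
      (by split_ifs <;> first | exact hy.le | exact le_rfl)
  have hdot : ∀ f : Fin (M + 1) → ℝ, ∑ v, ν v * f v = x * f (fid M (l - 1)) + y * f (fid M l) := by
    intro f
    simp only [ν, add_mul, ite_mul, zero_mul, Finset.sum_add_distrib]
    simp only [← fid_eq_iff (show 1 ≤ l - 1 by omega) (show l - 1 ≤ M + 1 by omega),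
      ← fid_eq_iff (show 1 ≤ l by omega) (show l ≤ M + 1 by omega), Finset.sum_ite_eq',
      Finset.mem_univ, if_true]
  have hval : ∀ v : Fin (M + 1), v.1 < M → (ν + Matrix.vecMul w A) v = p (v.1 + 1) := by
    intro v hv
    have h := hbal (v.1 + 1) (by omega) (by omega)
    rw [if_pos (show 1 ≤ v.1 + 1 ∧ v.1 + 1 ≤ M by omega), hWu, hWu] at h
    rw [← h, ← sum_mul_ThE (b := b) hW0 (by omega) (by omega)]
    rfl
  obtain ⟨lamF, hlamF, hlamF0, hres⟩ := exists_speed hA (ν := ν) (W := w) hν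
    (fun v => hW _) (fun v hv => by
      have h : 2 ≤ v.1 + 1 ∧ v.1 + 1 ≤ M - 1 := by
        by_contra h
        exact hv (hW0 _ h)
      rw [hval v (by omega)]
      exact hp.1 _ (by omega) (by omega)) hr
  let lam : ℕ → ℝ := fun j => if 2 ≤ j ∧ j ≤ M - 1 then lamF (fid M j) / s else 0
  have hlam : IntensityVec M lam := by
    refine ⟨fun j h2 hj => ?_, fun j h => if_neg h⟩
    simp only [lam, if_pos (And.intro h2 hj)]
    exact div_nonneg (hlamF _) hs.le
  have hlam_eq : (fun u : Fin (M + 1) => s * lam (u.1 + 1)) = lamF := by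
    funext u
    by_cases h : 2 ≤ u.1 + 1 ∧ u.1 + 1 ≤ M - 1
    · simp only [lam, if_pos h]
      rw [mul_div_cancel₀ _ hs.ne', ← (fid_eq_iff (by omega) (by omega) u).2 rfl]
    · simp only [lam, if_neg h, mul_zero]
      exact (hlamF0 u (hW0 _ h)).symm
  have hAe : ∀ u, ∑ v, A u v * e v = -ktil M i k (u.1 + 1) := Theta_mulVec_alive hi
  have hνe : ∑ v, ν v * e v = x + y := by
    rw [hdot]
    simp only [e, fid_val (show l - 1 ≤ M + 1 by omega), fid_val (show l ≤ M + 1 by omega)]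
    rw [if_neg (by omega), if_neg (by omega), mul_one, mul_one]
  have hpe : ∑ v, (ν + Matrix.vecMul w A) v * e v = 1 := by
    rw [Fin.sum_univ_castSucc, ← hp.2]
    have h1 : ∀ v : Fin M, (ν + Matrix.vecMul w A) v.castSucc * e v.castSucc = p (v.1 + 1) := by
      intro v
      rw [hval v.castSucc v.2]
      simp only [e, Fin.val_castSucc, if_neg v.2.ne, mul_one]
    simp only [h1, e, Fin.val_last, if_true, mul_zero, add_zero]
    rw [Fin.sum_univ_eq_sum_range (fun v => p (v + 1)) M, Finset.range_eq_Ico,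
      Finset.sum_Ico_add' p 0 M 1]
    rfl
  refine ⟨l, lam, x, y, hl2, hlM, hlam, hx, hy, ?_, ?_, ?_, ?_⟩
  · have h : ∑ v, (ν + Matrix.vecMul w A) v * e v =
        ∑ v, ν v * e v + ∑ u, w u * ∑ v, A u v * e v := by
      change (ν + Matrix.vecMul w A) ⬝ᵥ e = ν ⬝ᵥ e + w ⬝ᵥ Matrix.mulVec A e
      rw [add_dotProduct, Matrix.dotProduct_mulVec]
    rw [hpe, hνe] at h
    simp only [hAe] at h
    have h2 : ∑ u, w u * -ktil M i k (u.1 + 1) ≤ 0 :=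
      Finset.sum_nonpos fun u _ => mul_nonpos_of_nonneg_of_nonpos (hW _) (neg_nonpos.2 (hkt _))
    linarith
  · intro K hK hKle
    have hc : 0 ≤ 1 + s * K := by positivity
    have hNe : ∀ u, (speedMatrix A lamF).mulVec e u ≤ (1 + s * K) * e u := by
      intro u
      rw [speedMatrix_mulVec, hAe, ← hlam_eq]
      have hle : ktil M i k (u.1 + 1) * lam (u.1 + 1) ≤ K * e u := by
        by_cases h : 2 ≤ u.1 + 1 ∧ u.1 + 1 ≤ M - 1
        · simp only [e, if_neg (show ¬u.1 = M by omega), mul_one]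
          exact hKle _ h.1 h.2
        · rw [hlam.2 _ h, mul_zero]
          exact mul_nonneg hK (by simp only [e]; split_ifs <;> norm_num)
      have := mul_le_mul_of_nonneg_left hle hs.le
      linarith
    have h1 := fun u => hA.le_inv_pow_mulVec hlamF hc hNe r u
    have h2 : ∑ v, ν v * e v ≤
        ∑ v, ν v * ((1 + s * K) ^ r * ((speedMatrix A lamF)⁻¹ ^ r).mulVec e v) :=
      Finset.sum_le_sum fun v _ => mul_le_mul_of_nonneg_left (h1 v) (hν v)
    have h3 : ∑ v, ν v * ((speedMatrix A lamF)⁻¹ ^ r).mulVec e v = 1 := by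
      rw [← hpe, ← hres]
      exact Matrix.dotProduct_mulVec _ _ _
    rw [hνe] at h2
    simp only [mul_left_comm _ ((1 + s * K) ^ r)] at h2
    rwa [← Finset.mul_sum, h3, mul_one] at h2
  · rw [hlam_eq]
    exact hA.isUnit_det hlamF
  · intro j h1 hj
    rw [hlam_eq, ← hdot fun u => ((speedMatrix A lamF)⁻¹ ^ r) u (fid M j)]
    have h := hval (fid M j) (by rw [fid_val (by omega)]; omega)
    rw [fid_val (by omega), Nat.sub_add_cancel h1] at h
    rw [← h, ← hres]
    rfl

/-- negative binomial stopping. For `τ ~ NB(r, t/(t+hr))` (mean `hτ = t`),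
there exist `l`, an intensity vector `λ`, `β ∈ (0,1]` and `h₀ ∈ (0,1)` such that for every
`h ∈ (0,h₀)` there is an `α ∈ [(1 + (kλ)*t/r)^{-r}, 1]` for which the stopped discrete-time
chain has distribution `α·p`. -/
theorem stmt_4 (M : ℕ) (hM : 3 ≤ M) (i b k p : ℕ → ℝ) (t : ℝ) (ht : 0 < t)
    (r : ℕ) (hr : 1 ≤ r)
    (hi : ∀ j, 1 ≤ j → j ≤ M - 1 → i j < i (j + 1))
    (hb : DriftHyp M i b)
    (hk : ∀ j, 2 ≤ j → j ≤ M - 1 → 0 ≤ k j)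
    (hp : ProbVec M p) :
    ∃ l : ℕ, ∃ lam : ℕ → ℝ, ∃ β h0 : ℝ,
      2 ≤ l ∧ l ≤ M ∧ IntensityVec M lam ∧ 0 < β ∧ β ≤ 1 ∧ 0 < h0 ∧ h0 < 1 ∧
      ∀ h : ℝ, 0 < h → h < h0 →
        ∃ α : ℝ,
          (1 + (Finset.Icc 2 (M - 1)).sup'
                (Finset.nonempty_Icc.mpr (by omega))
                (fun j => ktil M i k j * lam j) * t / r) ^ (-(r : ℤ)) ≤ α ∧
          α ≤ 1 ∧
          IsUnit (1 - (t / (t + h * r)) • Ptilde M h i b k lam) ∧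
          ∀ j, 1 ≤ j → j ≤ M →
            (1 - t / (t + h * r)) ^ r *
                ((1 - β) *
                    ((1 - (t / (t + h * r)) • Ptilde M h i b k lam)⁻¹ ^ r)
                      (fid M (l - 1)) (fid M j)
                  + β *
                    ((1 - (t / (t + h * r)) • Ptilde M h i b k lam)⁻¹ ^ r)
                      (fid M l) (fid M j))
              = α * p j := by
  have hr0 : (0 : ℝ) < r := by exact_mod_cast hr
  obtain ⟨l, lam, x, y, hl2, hlM, hlam, hx, hy, hxy, hK, hdet, hN⟩ :=
    exists_intensity hM (div_pos ht hr0) hr hi hb hk hp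
  have hxy0 : 0 < x + y := by linarith
  refine ⟨l, lam, y / (x + y), 1 / 2, hl2, hlM, hlam, div_pos hy hxy0,
    (div_le_one hxy0).2 (by linarith), by norm_num, by norm_num, fun h hh _ =>
      ⟨(x + y)⁻¹, ?_, inv_le_one_of_one_le₀ hxy, ?_⟩⟩
  · set K := (Finset.Icc 2 (M - 1)).sup' (Finset.nonempty_Icc.mpr (by omega))
      (fun j => ktil M i k j * lam j)
    have hle : ∀ j, 2 ≤ j → j ≤ M - 1 → ktil M i k j * lam j ≤ K := fun j h2 hj =>
      Finset.le_sup' (fun j => ktil M i k j * lam j) (Finset.mem_Icc.2 ⟨h2, hj⟩)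
    have hK0 : 0 ≤ K := (mul_nonneg (ktil_nonneg hi hk 2) (hlam.1 2 le_rfl (by omega))).trans
      (hle 2 le_rfl (by omega))
    have hKs : 1 + K * t / r = 1 + t / r * K := by ring
    rw [zpow_neg, zpow_natCast, hKs]
    exact inv_anti₀ hxy0 (hK K hK0 hle)
  · have hden : 0 < t + h * r := by positivity
    have ha : 1 - t / (t + h * r) = h * r / (t + h * r) := by
      field_simp
      ring
    have ha0 : 1 - t / (t + h * r) ≠ 0 := by
      rw [ha]
      positivity
    have has : (1 - t / (t + h * r)) * (t / r) = t / (t + h * r) * h := by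
      rw [ha]
      field_simp
    rw [one_sub_smul_Ptilde has]
    refine ⟨?_, fun j h1 hj => ?_⟩
    · rw [Matrix.isUnit_iff_isUnit_det, Matrix.det_smul]
      exact (ha0.isUnit.pow _).mul hdet
    · have hpow := inv_smul_pow ha0 hdet r
      have he := hN j h1 hj
      rw [← hpow] at he
      simp only [Matrix.smul_apply, smul_eq_mul] at he
      rw [← he]
      field_simp
      ring
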